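/- The number of involutions of {1,...,n} avoiding both 3412 and 132 equals the Fibonacci number F_{n+1} (with F_1 = F_2 = 1). -/

import Mathlib

def Av3412 {n : ℕ} (σ : Equiv.Perm (Fin n)) : Prop :=
  ¬ ∃ i j k l : Fin n, i < j ∧ j < k ∧ k < l ∧ σ k < σ l ∧ σ l < σ i ∧ σ i < σ j

def Av132 {n : ℕ} (σ : Equiv.Perm (Fin n)) : Prop :=
  ¬ ∃ i j k : Fin n, i < j ∧ j < k ∧ σ i < σ k ∧ σ k < σ j

/-- Involutions of ℕ fixing everything from `n` on and avoiding 132 and 3412. -/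
def GoodInv (n : ℕ) (f : ℕ → ℕ) : Prop :=
  (∀ i, f (f i) = i) ∧ (∀ i, n ≤ i → f i = i) ∧
  (∀ i j k, i < j → j < k → f i < f k → f k < f j → False) ∧
  (∀ i j k l, i < j → j < k → k < l → f k < f l → f l < f i → f i < f j → False)

def wrapInv (n : ℕ) (g : ℕ → ℕ) : ℕ → ℕ := fun i =>
  if i = 0 then n + 1 else if i ≤ n then g (i - 1) + 1 else if i = n + 1 then 0 else i

theorem GoodInv.lt {n : ℕ} {f : ℕ → ℕ} (h : GoodInv n f) {i : ℕ} (hi : i < n) : f i < n := by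
  by_contra hc
  have h1 := h.2.1 (f i) (by omega)
  have h2 := h.1 i
  omega

theorem GoodInv.mono {n : ℕ} {f : ℕ → ℕ} (h : GoodInv n f) : GoodInv (n + 1) f :=
  ⟨h.1, fun i hi => h.2.1 i (by omega), h.2.2⟩

theorem wrapInv_cases (n : ℕ) (g : ℕ → ℕ) (i : ℕ) :
    (i = 0 ∧ wrapInv n g i = n + 1) ∨
    (∃ a, a < n ∧ i = a + 1 ∧ wrapInv n g i = g a + 1) ∨
    (i = n + 1 ∧ wrapInv n g i = 0) ∨ (n + 2 ≤ i ∧ wrapInv n g i = i) := by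
  unfold wrapInv
  rcases i with _ | a
  · simp
  · by_cases h : a < n
    · right; left; exact ⟨a, h, rfl, by simp; omega⟩
    · right; right
      by_cases h2 : a = n
      · left; simp [h2]
      · right; refine ⟨by omega, ?_⟩
        rw [if_neg (by omega), if_neg (by omega), if_neg (by omega)]

theorem GoodInv.wrap {n : ℕ} {g : ℕ → ℕ} (h : GoodInv n g) : GoodInv (n + 2) (wrapInv n g) := by
  have hlt : ∀ i, i < n → g i < n := fun i hi => h.lt hi
  obtain ⟨h1, h2, h3, h4⟩ := h
  refine ⟨?_, ?_, ?_, ?_⟩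
  · intro i
    rcases wrapInv_cases n g i with ⟨hi, e⟩ | ⟨a, ha, hi, e⟩ | ⟨hi, e⟩ | ⟨hi, e⟩
    · rw [e, hi]; simp [wrapInv]
    · rw [e, hi]; have := hlt a ha; have := h1 a; simp [wrapInv, *]
    · rw [e, hi]; simp [wrapInv]
    · rw [e, e]
  · intro i hi
    rcases wrapInv_cases n g i with ⟨hi, e⟩ | ⟨a, ha, hi, e⟩ | ⟨hi, e⟩ | ⟨hi, e⟩ <;> omega
  · intro i j k hij hjk p q
    rcases wrapInv_cases n g i with ⟨hi, e⟩ | ⟨a, ha, hi, e⟩ | ⟨hi, e⟩ | ⟨hi, e⟩ <;>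
    rcases wrapInv_cases n g j with ⟨hj, e'⟩ | ⟨b, hb, hj, e'⟩ | ⟨hj, e'⟩ | ⟨hj, e'⟩ <;>
    rcases wrapInv_cases n g k with ⟨hk, e''⟩ | ⟨c, hc, hk, e''⟩ | ⟨hk, e''⟩ | ⟨hk, e''⟩ <;>
    first
    | omega
    | exact h3 a b c (by omega) (by omega) (by omega) (by omega)
    | (have := hlt b hb; omega)
  · intro i j k l hij hjk hkl p q r
    rcases wrapInv_cases n g i with ⟨hi, e⟩ | ⟨a, ha, hi, e⟩ | ⟨hi, e⟩ | ⟨hi, e⟩ <;>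
    rcases wrapInv_cases n g l with ⟨hl, e'⟩ | ⟨d, hd, hl, e'⟩ | ⟨hl, e'⟩ | ⟨hl, e'⟩ <;>
    rcases wrapInv_cases n g j with ⟨hj, e''⟩ | ⟨b, hb, hj, e''⟩ | ⟨hj, e''⟩ | ⟨hj, e''⟩ <;>
    try omega
    all_goals
    rcases wrapInv_cases n g k with ⟨hk, e'''⟩ | ⟨c, hc, hk, e'''⟩ | ⟨hk, e'''⟩ | ⟨hk, e'''⟩ <;>
    first
    | omega
    | exact h4 a b c d (by omega) (by omega) (by omega) (by omega) (by omega) (by omega)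
    | (have := hlt a ha; omega)
    | (have := hlt b hb; omega)

theorem GoodInv.unwrap {n : ℕ} {f : ℕ → ℕ} (h : GoodInv (n + 2) f) (hf : f (n + 1) ≠ n + 1) :
    ∃ g, GoodInv n g ∧ wrapInv n g = f := by
  have hl : ∀ i, i < n + 2 → f i < n + 2 := fun i hi => h.lt hi
  obtain ⟨h1, h2, h3, h4⟩ := h
  have hk0 : f (n + 1) = 0 := by
    by_contra hk
    have a1 := h1 (n + 1)
    have a2 := h1 0
    have a3 := hl (n + 1) (by omega)
    have a4 := hl 0 (by omega)
    have a5 : f 0 ≠ n + 1 := by intro e; rw [e] at a2; omega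
    have a6 : f 0 ≠ f (n + 1) := by intro e; rw [e] at a2; omega
    have a7 : ¬ f 0 < f (n + 1) := fun e =>
      h3 0 (f (n + 1)) (n + 1) (by omega) (by omega) e (by omega)
    exact h4 0 (f (n + 1)) (f 0) (n + 1) (by omega) (by omega) (by omega) (by omega) (by omega)
      (by omega)
  have h0 : f 0 = n + 1 := by rw [← hk0, h1]
  have hpos : ∀ i, i < n → ∃ b, b < n ∧ f (i + 1) = b + 1 := by
    intro i hi
    have b1 := hl (i + 1) (by omega)
    have b2 := h1 (i + 1)
    have b3 : f (i + 1) ≠ 0 := by intro e; rw [e] at b2; omega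
    have b4 : f (i + 1) ≠ n + 1 := by intro e; rw [e] at b2; omega
    exact ⟨f (i + 1) - 1, by omega, by omega⟩
  obtain ⟨g, hg⟩ : ∃ g : ℕ → ℕ, g = fun i => if i < n then f (i + 1) - 1 else i := ⟨_, rfl⟩
  have hg1 : ∀ i, i < n → f (i + 1) = g i + 1 ∧ g i < n := by
    intro i hi
    obtain ⟨b, hb, e⟩ := hpos i hi
    simp [hg, hi, e, hb]
  have hg2 : ∀ i, n ≤ i → g i = i := by
    intro i hi
    simp [hg]; omega
  refine ⟨g, ⟨?_, hg2, ?_, ?_⟩, ?_⟩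
  · intro i
    by_cases hi : i < n
    · have c1 := hg1 i hi
      have c2 := hg1 (g i) c1.2
      have c3 := h1 (i + 1)
      rw [c1.1] at c3
      omega
    · rw [hg2 i (by omega), hg2 i (by omega)]
  · intro i j k hij hjk p q
    have := hg1 i
    have := hg1 j
    have := hg1 k
    have := hg2 i
    have := hg2 j
    have := hg2 k
    exact h3 (i + 1) (j + 1) (k + 1) (by omega) (by omega) (by omega) (by omega)
  · intro i j k l hij hjk hkl p q r
    have := hg1 i
    have := hg1 j
    have := hg1 k
    have := hg1 l
    have := hg2 i
    have := hg2 j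
    have := hg2 k
    have := hg2 l
    exact h4 (i + 1) (j + 1) (k + 1) (l + 1) (by omega) (by omega) (by omega) (by omega) (by omega)
      (by omega)
  · funext i
    rcases wrapInv_cases n g i with ⟨hi, e⟩ | ⟨a, ha, hi, e⟩ | ⟨hi, e⟩ | ⟨hi, e⟩
    · rw [e, hi, h0]
    · rw [e, hi, (hg1 a ha).1]
    · rw [e, hi, hk0]
    · rw [e, h2 i hi]

theorem goodInv_id (n : ℕ) : GoodInv n id := by
  refine ⟨fun i => rfl, fun i _ => rfl, ?_, ?_⟩ <;> simp only [id] <;> intros <;> omega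

theorem goodInv_one {f : ℕ → ℕ} (h : GoodInv 1 f) : f = id := by
  funext i
  by_cases hi : i < 1
  · have := h.lt hi
    simp only [id]; omega
  · exact h.2.1 i (by omega)

theorem setOf_goodInv_succ (n : ℕ) :
    {f | GoodInv (n + 2) f} = {f | GoodInv (n + 1) f} ∪ wrapInv n '' {f | GoodInv n f} := by
  ext f
  simp only [Set.mem_ofPred_eq, Set.mem_union, Set.mem_image]
  constructor
  · intro h
    by_cases hf : f (n + 1) = n + 1
    · left
      refine ⟨h.1, ?_, h.2.2⟩
      intro i hi
      rcases Nat.eq_or_lt_of_le hi with e | e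
      · rw [← e, hf]
      · exact h.2.1 i e
    · right; exact h.unwrap hf
  · rintro (h | ⟨g, h, rfl⟩)
    · exact h.mono
    · exact h.wrap

theorem goodInv_card (n : ℕ) :
    ({f | GoodInv n f}.Finite ∧ {f | GoodInv n f}.ncard = Nat.fib (n + 1)) ∧
    ({f | GoodInv (n + 1) f}.Finite ∧ {f | GoodInv (n + 1) f}.ncard = Nat.fib (n + 2)) := by
  induction n with
  | zero =>
    have e1 : {f | GoodInv 1 f} = {id} := by
      ext f
      exact ⟨fun h => goodInv_one h, fun h => by rw [Set.mem_singleton_iff.1 h]; exact goodInv_id 1⟩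
    have e0 : {f | GoodInv 0 f} = {id} := by
      ext f
      exact ⟨fun h => goodInv_one h.mono,
        fun h => by rw [Set.mem_singleton_iff.1 h]; exact goodInv_id 0⟩
    simp [e0, e1]
  | succ n ih =>
    obtain ⟨⟨f1, c1⟩, f2, c2⟩ := ih
    refine ⟨⟨f2, c2⟩, ?_⟩
    rw [show n + 1 + 1 = n + 2 from rfl, setOf_goodInv_succ]
    refine ⟨f2.union (f1.image _), ?_⟩
    rw [Set.ncard_union_eq ?_ f2 (f1.image _), Set.InjOn.ncard_image, c1, c2]
    · rw [Nat.fib_add_two (n := n + 1)]; exact Nat.add_comm _ _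
    · intro g hg g' hg' e
      funext i
      by_cases hi : i < n
      · have := congrFun e (i + 1)
        simpa [wrapInv, Nat.succ_le_iff, hi] using this
      · rw [hg.2.1 i (by omega), hg'.2.1 i (by omega)]
    · rw [Set.disjoint_left]
      rintro f hf ⟨g, hg, rfl⟩
      have := hf.2.1 (n + 1) le_rfl
      simp [wrapInv] at this

/-- Extension of a permutation of `Fin n` to ℕ by the identity. -/
def extInv {n : ℕ} (τ : Equiv.Perm (Fin n)) : ℕ → ℕ :=
  fun i => if h : i < n then (τ ⟨i, h⟩ : ℕ) else i

theorem extInv_cases {n : ℕ} (τ : Equiv.Perm (Fin n)) (i : ℕ) :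
    (∃ a : Fin n, (a : ℕ) = i ∧ extInv τ i = τ a) ∨ (n ≤ i ∧ extInv τ i = i) := by
  by_cases h : i < n
  · left; exact ⟨⟨i, h⟩, rfl, by simp [extInv, h]⟩
  · right; exact ⟨by omega, by simp [extInv, h]⟩

theorem extInv_coe {n : ℕ} (τ : Equiv.Perm (Fin n)) (a : Fin n) : extInv τ a = τ a := by
  simp [extInv]

theorem extInv_good {n : ℕ} (τ : Equiv.Perm (Fin n)) (h : τ * τ = 1 ∧ Av3412 τ ∧ Av132 τ) :
    GoodInv n (extInv τ) := by
  obtain ⟨h1, h2, h3⟩ := h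
  refine ⟨?_, ?_, ?_, ?_⟩
  · intro i
    rcases extInv_cases τ i with ⟨a, rfl, e⟩ | ⟨hi, e⟩
    · rw [e, extInv_coe]
      have : (τ * τ) a = a := by rw [h1]; rfl
      exact congrArg Fin.val this
    · rw [e, e]
  · intro i hi
    simp [extInv, Nat.not_lt.2 hi]
  · intro i j k hij hjk p q
    rcases extInv_cases τ k with ⟨c, rfl, ec⟩ | ⟨hk, ec⟩
    · rcases extInv_cases τ j with ⟨b, rfl, eb⟩ | ⟨hj, eb⟩
      · rcases extInv_cases τ i with ⟨a, rfl, ea⟩ | ⟨hi, ea⟩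
        · exact h3 ⟨a, b, c, hij, hjk, by omega, by omega⟩
        · omega
      · omega
    · rcases extInv_cases τ j with ⟨b, rfl, eb⟩ | ⟨hj, eb⟩ <;> omega
  · intro i j k l hij hjk hkl p q r
    rcases extInv_cases τ l with ⟨d, rfl, ed⟩ | ⟨hl, ed⟩
    · rcases extInv_cases τ k with ⟨c, rfl, ec⟩ | ⟨hk, ec⟩
      · rcases extInv_cases τ j with ⟨b, rfl, eb⟩ | ⟨hj, eb⟩
        · rcases extInv_cases τ i with ⟨a, rfl, ea⟩ | ⟨hi, ea⟩
          · exact h2 ⟨a, b, c, d, hij, hjk, hkl, by omega, by omega, by omega⟩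
          · omega
        · omega
      · omega
    · rcases extInv_cases τ i with ⟨a, rfl, ea⟩ | ⟨hi, ea⟩ <;> omega

theorem exists_extInv {n : ℕ} {f : ℕ → ℕ} (h : GoodInv n f) :
    ∃ τ : Equiv.Perm (Fin n), (τ * τ = 1 ∧ Av3412 τ ∧ Av132 τ) ∧ extInv τ = f := by
  have hinv : Function.Involutive (fun i : Fin n => (⟨f i, h.lt i.2⟩ : Fin n)) :=
    fun i => Fin.ext (h.1 i)
  refine ⟨hinv.toPerm, ⟨?_, ?_, ?_⟩, ?_⟩
  · ext i
    exact h.1 i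
  · rintro ⟨i, j, k, l, a, b, c, p, q, r⟩
    exact h.2.2.2 i j k l a b c p q r
  · rintro ⟨i, j, k, a, b, p, q⟩
    exact h.2.2.1 i j k a b p q
  · funext i
    by_cases hi : i < n
    · simp [extInv, hi]
    · simp [extInv, hi, h.2.1 i (by omega)]

theorem card_involutions_avoiding_3412_132 (n : ℕ) :
    Nat.card {τ : Equiv.Perm (Fin n) // τ * τ = 1 ∧ Av3412 τ ∧ Av132 τ} =
      Nat.fib (n + 1) := by
  rw [← (goodInv_card n).1.2, ← Nat.card_coe_set_eq]
  refine Nat.card_congr (Equiv.ofBijective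
    (fun τ => (⟨extInv τ.1, extInv_good τ.1 τ.2⟩ : {f | GoodInv n f})) ⟨?_, ?_⟩)
  · intro τ τ' e
    have e' : extInv τ.1 = extInv τ'.1 := congrArg Subtype.val e
    ext i
    rw [← extInv_coe, ← extInv_coe, e']
  · rintro ⟨f, hf⟩
    obtain ⟨τ, h, rfl⟩ := exists_extInv hf
    exact ⟨⟨τ, h⟩, rfl⟩
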